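/- Let σ be a distortion function. For every measurable 𝕂-valued Z on (Ω,𝓕,P): |Z|*_{σ,∞} = inf{η ≥ 0 : ∫₀¹ F_{|Z|}^{-1}(u) F(u) du ≤ η ∫₀¹ σ(u) F(u) du for every nondecreasing F : [0,1) → [0,∞)}; and for p ∈ (1,∞) with conjugate exponent q, |Z|*_{σ,q} = inf{‖Z'‖_{σ,q} : Z' measurable such that ∫₀¹ F_{|Z|}^{-1}(u) F(u) du ≤ ∫₀¹ σ(u) F_{|Z'|}^{-1}(u) F(u) du for every nondecreasing F : [0,1) → [0,∞)}. -/

import Mathlib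

open MeasureTheory
open scoped ENNReal NNReal

noncomputable section

variable {Ω : Type*} [MeasurableSpace Ω]

/-- A `[0,1]`-valued random variable uniformly distributed on `[0,1]`:
`P(U ≤ u) = u` for all `u ∈ [0,1]`. -/
def IsUniformRV (P : Measure Ω) (U : Ω → ℝ) : Prop :=
  Measurable U ∧ (∀ ω, U ω ∈ Set.Icc (0 : ℝ) 1) ∧
    ∀ u ∈ Set.Icc (0 : ℝ) 1, P {ω | U ω ≤ u} = ENNReal.ofReal u

/-- A distortion function: nondecreasing, nonnegative, left-continuous on `[0,1)`
with `∫₀¹ σ(u) du = 1`. -/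
structure IsDistortion (σ : ℝ → ℝ) : Prop where
  nonneg : ∀ u ∈ Set.Ico (0 : ℝ) 1, 0 ≤ σ u
  mono : MonotoneOn σ (Set.Ico (0 : ℝ) 1)
  left_continuous : ∀ u ∈ Set.Ioo (0 : ℝ) 1,
    Filter.Tendsto σ (nhdsWithin u (Set.Iio u)) (nhds (σ u))
  integral_one : ∫ u in Set.Ioo (0 : ℝ) 1, σ u = 1

/-- `‖Y‖_{σ,p}^p := sup over uniform U of E[σ(U)·‖Y‖^p]`. -/
def sigmaPow (P : Measure Ω) (σ : ℝ → ℝ) (p : ℝ) {X : Type*} [NormedAddCommGroup X]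
    (Y : Ω → X) : ℝ≥0∞ :=
  ⨆ (U : Ω → ℝ) (_ : IsUniformRV P U),
    ∫⁻ ω, ENNReal.ofReal (σ (U ω)) * (‖Y ω‖₊ : ℝ≥0∞) ^ p ∂P

/-- The norm `‖Y‖_{σ,p}`. -/
def sigmaNorm (P : Measure Ω) (σ : ℝ → ℝ) (p : ℝ) {X : Type*} [NormedAddCommGroup X]
    (Y : Ω → X) : ℝ≥0∞ :=
  sigmaPow P σ p Y ^ (1 / p)

/-- Membership in `L_σ^p(P,X)`: strongly measurable with finite `σ,p`-norm. -/
def MemLsigma (P : Measure Ω) (σ : ℝ → ℝ) (p : ℝ) {X : Type*} [NormedAddCommGroup X]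
    (Y : Ω → X) : Prop :=
  AEStronglyMeasurable Y P ∧ sigmaPow P σ p Y < ∞

/-- The generalized inverse distribution function (quantile function)
`F_g^{-1}(α) = inf {q : P(g ≤ q) ≥ α}`. -/
def quantileFn (P : Measure Ω) (g : Ω → ℝ) (α : ℝ) : ℝ :=
  sInf {q : ℝ | ENNReal.ofReal α ≤ P {ω | g ω ≤ q}}

variable {𝕂 : Type*} [RCLike 𝕂]

/-- The Köthe dual of `L_σ^p(P)`:
`{Z measurable : Z·Y ∈ L¹(P) for all Y ∈ L_σ^p(P)}`. -/
def KoetheDual (P : Measure Ω) (σ : ℝ → ℝ) (p : ℝ) (Z : Ω → 𝕂) : Prop :=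
  AEStronglyMeasurable Z P ∧
    ∀ Y : Ω → 𝕂, MemLsigma P σ p Y → Integrable (fun ω => Z ω * Y ω) P

/-- The average value-at-risk of level `α` of the (nonnegative) random variable `g`:
`AV@R_α(g) = (1/(1−α)) ∫_α^1 F_g^{-1}(u) du`. -/
def avar (P : Measure Ω) (g : Ω → ℝ) (α : ℝ) : ℝ≥0∞ :=
  ENNReal.ofReal (1 / (1 - α)) *
    ∫⁻ u in Set.Ioo α 1, ENNReal.ofReal (quantileFn P g u)

/-- `Z'` σ-dominates `Z`: there is a uniform `U` with
`AV@R_α(σ(U)·|Z'|) ≥ AV@R_α(|Z|)` for all `α < 1`. -/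
def SigmaDominates (P : Measure Ω) (σ : ℝ → ℝ) (Z' Z : Ω → 𝕂) : Prop :=
  ∃ U : Ω → ℝ, IsUniformRV P U ∧ ∀ α ∈ Set.Ico (0 : ℝ) 1,
    avar P (fun ω => ‖Z ω‖) α ≤ avar P (fun ω => σ (U ω) * ‖Z' ω‖) α

/-- `|Z|*_{σ,∞} = sup_{α ∈ [0,1)} AV@R_α(|Z|) / ((1/(1−α))·S_σ(α))
 = sup_{α ∈ [0,1)} (∫_α^1 F_{|Z|}^{-1}(u) du) / (∫_α^1 σ(u) du)`. -/
def dualNormInf (P : Measure Ω) (σ : ℝ → ℝ) (Z : Ω → 𝕂) : ℝ≥0∞ :=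
  ⨆ (α : ℝ) (_ : α ∈ Set.Ico (0 : ℝ) 1),
    (∫⁻ u in Set.Ioo α 1, ENNReal.ofReal (quantileFn P (fun ω => ‖Z ω‖) u)) /
      ENNReal.ofReal (∫ u in Set.Ioo α 1, σ u)

/-- `|Z|*_{σ,q} = inf {‖Z'‖_{σ,q} : Z' σ-dominates Z}` (with `inf ∅ = ∞`). -/
def dualNormQ (P : Measure Ω) (σ : ℝ → ℝ) (q : ℝ) (Z : Ω → 𝕂) : ℝ≥0∞ :=
  ⨅ (Z' : Ω → 𝕂) (_ : AEStronglyMeasurable Z' P ∧ SigmaDominates P σ Z' Z),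
    sigmaNorm P σ q Z'

lemma IsUniformRV.map_eq {P : Measure Ω} [IsProbabilityMeasure P] {U : Ω → ℝ}
    (hU : IsUniformRV P U) : P.map U = volume.restrict (Set.Ioo (0 : ℝ) 1) := by
  have := Measure.isProbabilityMeasure_map (μ := P) hU.1.aemeasurable
  refine Measure.ext_of_Iic _ _ fun a => ?_
  rw [Measure.map_apply hU.1 measurableSet_Iic,
    Measure.restrict_congr_set (Ioo_ae_eq_Ioc (μ := volume) (a := (0 : ℝ)) (b := 1)),
    Measure.restrict_apply measurableSet_Iic, Set.inter_comm, Set.Ioc_inter_Iic, Real.volume_Ioc,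
    sub_zero]
  rcases lt_or_ge a 0 with ha | ha
  · have : U ⁻¹' Set.Iic a = ∅ := by
      ext ω
      simpa using lt_of_lt_of_le ha (hU.2.1 ω).1
    rw [this, measure_empty, ENNReal.ofReal_of_nonpos (min_le_of_right_le ha.le)]
  rcases le_or_gt a 1 with h1 | h1
  · rw [min_eq_right h1]
    exact hU.2.2 a ⟨ha, h1⟩
  · have : U ⁻¹' Set.Iic a = Set.univ := by
      ext ω
      simpa using (hU.2.1 ω).2.trans h1.le
    rw [this, measure_univ, min_eq_left h1.le, ENNReal.ofReal_one]

lemma IsUniformRV.ae_mem_Ioo {P : Measure Ω} [IsProbabilityMeasure P] {U : Ω → ℝ}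
    (hU : IsUniformRV P U) : ∀ᵐ ω ∂P, U ω ∈ Set.Ioo (0 : ℝ) 1 := by
  refine ae_of_ae_map hU.1.aemeasurable ?_
  rw [hU.map_eq]
  exact ae_restrict_mem measurableSet_Ioo

lemma quantileFn_le_iff {P : Measure Ω} [IsProbabilityMeasure P] {X : Ω → ℝ}
    (hX : AEMeasurable X P) {u : ℝ} (hu : u ∈ Set.Ioo (0 : ℝ) 1) {x : ℝ} :
    quantileFn P X u ≤ x ↔ ENNReal.ofReal u ≤ P {ω | X ω ≤ x} := by
  have := Measure.isProbabilityMeasure_map hX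
  set F := ProbabilityTheory.cdf (P.map X) with hF
  have key (y : ℝ) : ENNReal.ofReal u ≤ P {ω | X ω ≤ y} ↔ u ≤ F y := by
    have : P {ω | X ω ≤ y} = ENNReal.ofReal (F y) := by
      rw [hF, ProbabilityTheory.ofReal_cdf,
        Measure.map_apply_of_aemeasurable hX measurableSet_Iic]
      rfl
    rw [this, ENNReal.ofReal_le_ofReal_iff (ProbabilityTheory.cdf_nonneg _ _)]
  have hbdd : BddBelow {q | u ≤ F q} := by
    obtain ⟨b, hb⟩ := ((ProbabilityTheory.tendsto_cdf_atBot (P.map X)).eventually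
      (gt_mem_nhds hu.1)).exists
    refine ⟨b, fun q hq => ?_⟩
    by_contra! h
    exact absurd (hq.trans (F.mono h.le)) (not_le.2 hb)
  have hne : {q | u ≤ F q}.Nonempty := by
    obtain ⟨b, hb⟩ := ((ProbabilityTheory.tendsto_cdf_atTop (P.map X)).eventually
      (lt_mem_nhds hu.2)).exists
    exact ⟨b, hb.le⟩
  simp only [quantileFn, key]
  refine ⟨fun h => ?_, fun h => csInf_le hbdd h⟩
  have hr : Filter.Tendsto F (nhdsWithin x (Set.Ioi x)) (nhds (F x)) :=
    (F.right_continuous x).mono Set.Ioi_subset_Ici_self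
  refine ge_of_tendsto hr ?_
  filter_upwards [self_mem_nhdsWithin] with y hy
  obtain ⟨q, hq, hqy⟩ := exists_lt_of_csInf_lt hne (lt_of_le_of_lt h hy)
  exact hq.trans (F.mono hqy.le)

lemma monotoneOn_quantileFn {P : Measure Ω} [IsProbabilityMeasure P] {X : Ω → ℝ}
    (hX : AEMeasurable X P) : MonotoneOn (quantileFn P X) (Set.Ioo (0 : ℝ) 1) := by
  intro u hu v hv huv
  rw [quantileFn_le_iff hX hu]
  exact (ENNReal.ofReal_le_ofReal huv).trans ((quantileFn_le_iff hX hv).1 le_rfl)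

lemma quantileFn_nonneg {P : Measure Ω} [IsProbabilityMeasure P] {X : Ω → ℝ}
    (hX : AEMeasurable X P) (h0 : 0 ≤ᵐ[P] X) {u : ℝ} (hu : u ∈ Set.Ioo (0 : ℝ) 1) :
    0 ≤ quantileFn P X u := by
  have h := (quantileFn_le_iff hX hu).1 le_rfl
  by_contra! hneg
  have : P {ω | X ω ≤ quantileFn P X u} = 0 := by
    rw [← compl_mem_ae_iff]
    filter_upwards [h0] with ω hω
    simpa using lt_of_lt_of_le hneg hω
  rw [this, nonpos_iff_eq_zero, ENNReal.ofReal_eq_zero] at h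
  exact absurd hu.1 (not_lt.2 h)

lemma quantileFn_congr_ae {P : Measure Ω} {X Y : Ω → ℝ} (h : X =ᵐ[P] Y) :
    quantileFn P X = quantileFn P Y := by
  ext u
  have (q : ℝ) : P {ω | X ω ≤ q} = P {ω | Y ω ≤ q} := by
    refine measure_congr ?_
    filter_upwards [h] with ω hω
    exact propext (by change X ω ≤ q ↔ Y ω ≤ q; rw [hω])
  simp only [quantileFn, this]

lemma continuous_cdf (μ : Measure ℝ) [IsProbabilityMeasure μ] [NullSingletonClass μ] :
    Continuous (ProbabilityTheory.cdf μ) := by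
  refine continuous_iff_continuousAt.2 fun x => ?_
  set F := ProbabilityTheory.cdf μ with hF
  rw [F.mono.continuousAt_iff_leftLim_eq_rightLim, F.rightLim_eq]
  refine le_antisymm (F.mono.leftLim_le le_rfl) ?_
  have h : F.measure {x} = 0 := by
    rw [hF, ProbabilityTheory.measure_cdf]
    exact measure_singleton x
  rw [StieltjesFunction.measure_singleton, ENNReal.ofReal_eq_zero] at h
  linarith

lemma isUniformRV_cdf_comp {P : Measure Ω} [IsProbabilityMeasure P] {T : Ω → ℝ}
    (hT : Measurable T) (h0 : ∀ t, P {ω | T ω = t} = 0) :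
    IsUniformRV P (fun ω => ProbabilityTheory.cdf (P.map T) (T ω)) := by
  have := Measure.isProbabilityMeasure_map (μ := P) hT.aemeasurable
  have : NullSingletonClass (P.map T) :=
    ⟨fun t => by
      rw [Measure.map_apply hT (measurableSet_singleton t)]
      exact h0 t⟩
  have hcont := continuous_cdf (P.map T)
  set F := ProbabilityTheory.cdf (P.map T) with hF
  have hmid : ∀ u ∈ Set.Ioo (0 : ℝ) 1, P {ω | F (T ω) ≤ u} = ENNReal.ofReal u := by
    intro u hu
    obtain ⟨a, ha⟩ := ((ProbabilityTheory.tendsto_cdf_atBot (P.map T)).eventually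
      (gt_mem_nhds hu.1)).exists
    obtain ⟨b, hb⟩ := ((ProbabilityTheory.tendsto_cdf_atTop (P.map T)).eventually
      (lt_mem_nhds hu.2)).exists
    obtain ⟨t, ht⟩ : u ∈ Set.range F :=
      mem_range_of_exists_le_of_exists_ge hcont ⟨a, ha.le⟩ ⟨b, hb.le⟩
    have hbdd : BddAbove {s | F s ≤ u} := by
      refine ⟨b, fun q hq => ?_⟩
      by_contra! h
      exact absurd ((F.mono h.le).trans hq) (not_le.2 hb)
    have hmem : sSup {s | F s ≤ u} ∈ {s | F s ≤ u} :=
      (isClosed_le hcont continuous_const).csSup_mem ⟨t, ht.le⟩ hbdd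
    have hval : F (sSup {s | F s ≤ u}) = u :=
      le_antisymm hmem (ht.symm.le.trans (F.mono (le_csSup hbdd ht.le)))
    have hset : {ω | F (T ω) ≤ u} = T ⁻¹' Set.Iic (sSup {s | F s ≤ u}) := by
      ext ω
      exact ⟨fun h => le_csSup hbdd h, fun h => (F.mono h).trans hmem⟩
    rw [hset, ← Measure.map_apply hT measurableSet_Iic, ← ProbabilityTheory.ofReal_cdf,
      ← hF, hval]
  refine ⟨hcont.measurable.comp hT, fun ω =>
    ⟨ProbabilityTheory.cdf_nonneg _ _, ProbabilityTheory.cdf_le_one _ _⟩, fun u hu => ?_⟩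
  rcases hu.1.eq_or_lt with rfl | hu0
  · rw [ENNReal.ofReal_zero, ← nonpos_iff_eq_zero]
    refine ENNReal.le_of_forall_pos_le_add fun ε hε _ => ?_
    have hε' : min (ε : ℝ) (1 / 2) ∈ Set.Ioo (0 : ℝ) 1 :=
      ⟨lt_min (by exact_mod_cast hε) (by norm_num), min_lt_of_right_lt (by norm_num)⟩
    calc P {ω | F (T ω) ≤ 0} ≤ P {ω | F (T ω) ≤ min (ε : ℝ) (1 / 2)} :=
          measure_mono fun ω h => le_trans h hε'.1.le
      _ = ENNReal.ofReal (min (ε : ℝ) (1 / 2)) := hmid _ hε'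
      _ ≤ ENNReal.ofReal ε := ENNReal.ofReal_le_ofReal (min_le_left _ _)
      _ = 0 + ε := by rw [ENNReal.ofReal_coe_nnreal, zero_add]
  rcases hu.2.eq_or_lt with rfl | hu1
  · have : {ω | F (T ω) ≤ 1} = Set.univ :=
      Set.eq_univ_of_forall fun ω => ProbabilityTheory.cdf_le_one _ _
    rw [this, measure_univ, ENNReal.ofReal_one]
  · exact hmid u ⟨hu0, hu1⟩

/-- On a space carrying a uniform random variable, every random variable has a continuously
distributed refinement. -/
lemma exists_refinement_null_fibers {P : Measure Ω} [IsProbabilityMeasure P]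
    (hrich : ∃ U : Ω → ℝ, IsUniformRV P U) {X : Ω → ℝ} (hX : Measurable X) :
    ∃ T : Ω → ℝ, Measurable T ∧ (∀ t, P {ω | T ω = t} = 0) ∧
      ∀ ω ω', X ω < X ω' → T ω < T ω' := by
  obtain ⟨V, hV⟩ := hrich
  set μ := P.map X with hμ
  have := Measure.isProbabilityMeasure_map (μ := P) hX.aemeasurable
  set m : ℝ → ℝ := fun x => μ.real (Set.Iio x)
  set M : ℝ → ℝ := fun x => μ.real (Set.Iic x)
  have hm : Monotone m := fun x y h => measureReal_mono (Set.Iio_subset_Iio h)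
  have hM : Monotone M := fun x y h => measureReal_mono (Set.Iic_subset_Iic.2 h)
  have hmM (x : ℝ) : m x ≤ M x := measureReal_mono Set.Iio_subset_Iic_self
  have hMm {x y : ℝ} (h : x < y) : M x ≤ m y := measureReal_mono (Set.Iic_subset_Iio.2 h)
  have hsing (x : ℝ) : M x = m x + μ.real {x} := by
    have : Set.Iic x = Set.Iio x ∪ {x} := (Set.Iio_union_right).symm
    simp only [M, m]
    rw [this, measureReal_union (by simp) (measurableSet_singleton x)]
  set T : Ω → ℝ := fun ω => X ω + (m (X ω) + (M (X ω) - m (X ω)) * V ω) with hT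
  have hlt : ∀ ω ω', X ω < X ω' → T ω < T ω' := by
    intro ω ω' h
    have h1 := hMm h
    have h2 : (M (X ω) - m (X ω)) * V ω ≤ M (X ω) - m (X ω) :=
      mul_le_of_le_one_right (sub_nonneg.2 (hmM _)) (hV.2.1 ω).2
    have h3 : 0 ≤ (M (X ω') - m (X ω')) * V ω' :=
      mul_nonneg (sub_nonneg.2 (hmM _)) (hV.2.1 ω').1
    simp only [hT]
    linarith
  refine ⟨T, ?_, fun t => ?_, hlt⟩
  · have hmX := hm.measurable.comp hX
    exact hX.add (hmX.add (((hM.measurable.comp hX).sub hmX).mul hV.1))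
  · rcases Set.eq_empty_or_nonempty {ω | T ω = t} with he | ⟨ω₀, h₀⟩
    · rw [he, measure_empty]
    have hXeq : ∀ ω, T ω = t → X ω = X ω₀ := by
      intro ω h
      rcases lt_trichotomy (X ω) (X ω₀) with h' | h' | h'
      · exact absurd (hlt _ _ h') (by rw [h, h₀]; exact lt_irrefl t)
      · exact h'
      · exact absurd (hlt _ _ h') (by rw [h, h₀]; exact lt_irrefl t)
    by_cases hz : μ.real {X ω₀} = 0
    · rw [measureReal_eq_zero_iff, hμ, Measure.map_apply hX (measurableSet_singleton _)] at hz
      exact measure_mono_null (fun ω h => hXeq ω h) hz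
    · have hV0 : P (V ⁻¹' {V ω₀}) = 0 := by
        rw [← Measure.map_apply hV.1 (measurableSet_singleton _), hV.map_eq]
        exact measure_singleton _
      refine measure_mono_null (fun ω h => ?_) hV0
      have h1 : T ω = T ω₀ := h.trans h₀.symm
      simp only [hT, hXeq ω h] at h1
      have h2 : μ.real {X ω₀} * V ω = μ.real {X ω₀} * V ω₀ := by
        rw [hsing] at h1
        linarith
      exact mul_left_cancel₀ hz h2

/-- On a space carrying a uniform random variable, every random variable `X` is coupled
with a uniform one whose quantile transform does not exceed `X`. -/
lemma exists_uniform_quantileFn_le {P : Measure Ω} [IsProbabilityMeasure P]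
    (hrich : ∃ U : Ω → ℝ, IsUniformRV P U) {X : Ω → ℝ} (hX : AEMeasurable X P) :
    ∃ U : Ω → ℝ, IsUniformRV P U ∧ ∀ᵐ ω ∂P, quantileFn P X (U ω) ≤ X ω := by
  obtain ⟨T, hT, h0, hlt⟩ := exists_refinement_null_fibers hrich hX.measurable_mk
  have hU := isUniformRV_cdf_comp hT h0
  have := Measure.isProbabilityMeasure_map (μ := P) hT.aemeasurable
  refine ⟨_, hU, ?_⟩
  filter_upwards [hU.ae_mem_Ioo, hX.ae_eq_mk] with ω hω hXω
  rw [quantileFn_congr_ae hX.ae_eq_mk, hXω, quantileFn_le_iff hX.measurable_mk.aemeasurable hω,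
    ProbabilityTheory.ofReal_cdf, Measure.map_apply hT measurableSet_Iic]
  refine measure_mono fun ω' h => ?_
  by_contra! h'
  exact absurd (hlt ω ω' (not_le.1 h')) (not_lt.2 h)

lemma exists_Ioo_subset_subset_Ico {D : Set ℝ} (hD : D ⊆ Set.Ioo (0 : ℝ) 1)
    (hup : ∀ u ∈ D, ∀ v ∈ Set.Ioo (0 : ℝ) 1, u ≤ v → v ∈ D) :
    ∃ β ∈ Set.Icc (0 : ℝ) 1, Set.Ioo β 1 ⊆ D ∧ D ⊆ Set.Ico β 1 := by
  have hbdd : BddBelow (insert 1 D) := by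
    refine ⟨0, ?_⟩
    rintro x (rfl | hx)
    exacts [zero_le_one, (hD hx).1.le]
  have h0 : 0 ≤ sInf (insert 1 D) := by
    refine le_csInf (Set.insert_nonempty _ _) ?_
    rintro x (rfl | hx)
    exacts [zero_le_one, (hD hx).1.le]
  refine ⟨sInf (insert 1 D), ⟨h0, csInf_le hbdd (Set.mem_insert _ _)⟩, fun v hv => ?_,
    fun v hv => ⟨csInf_le hbdd (Set.mem_insert_of_mem _ hv), (hD hv).2⟩⟩
  obtain ⟨u, hu, huv⟩ := exists_lt_of_csInf_lt (Set.insert_nonempty _ _) hv.1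
  rcases hu with rfl | hu
  · exact absurd hv.2 huv.not_gt
  · exact hup u hu v ⟨h0.trans_lt hv.1, hv.2⟩ huv.le

lemma MonotoneOn.exists_superlevel_Ioo {F : ℝ → ℝ} (hF : MonotoneOn F (Set.Ioo (0 : ℝ) 1))
    (t : ℝ) : ∃ β ∈ Set.Icc (0 : ℝ) 1, Set.Ioo β 1 ⊆ {u | t < F u} ∧
      Set.Ioo (0 : ℝ) 1 ∩ {u | t < F u} ⊆ Set.Ico β 1 := by
  obtain ⟨β, hβ, h1, h2⟩ := exists_Ioo_subset_subset_Ico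
    (D := Set.Ioo (0 : ℝ) 1 ∩ {u | t < F u}) Set.inter_subset_left
    fun u hu v hv huv => ⟨hv, lt_of_lt_of_le hu.2 (hF hu.1 hv huv)⟩
  exact ⟨β, hβ, h1.trans Set.inter_subset_right, h2⟩

lemma lintegral_mul_ofReal_eq {S : Type*} [MeasurableSpace S] {ν : Measure S} {k : S → ℝ≥0∞}
    {F : S → ℝ} (hk : AEMeasurable k ν) (hF : AEMeasurable F ν) (hF0 : 0 ≤ᵐ[ν] F) :
    ∫⁻ u, k u * ENNReal.ofReal (F u) ∂ν =
      ∫⁻ t in Set.Ioi (0 : ℝ), ν.withDensity k {u | t < F u} := by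
  have hac := withDensity_absolutelyContinuous ν k
  rw [← lintegral_eq_lintegral_meas_lt _ (hac.ae_le hF0) (hF.mono_ac hac),
    lintegral_withDensity_eq_lintegral_mul₀ hk hF.ennreal_ofReal]
  rfl

/-- Comparison of all tail integrals is the same as comparison against all nonnegative
nondecreasing weights. -/
lemma forall_setLIntegral_Ioo_le_iff {f g : ℝ → ℝ≥0∞}
    (hf : AEMeasurable f (volume.restrict (Set.Ioo (0 : ℝ) 1)))
    (hg : AEMeasurable g (volume.restrict (Set.Ioo (0 : ℝ) 1))) :
    (∀ α ∈ Set.Ico (0 : ℝ) 1, ∫⁻ u in Set.Ioo α 1, f u ≤ ∫⁻ u in Set.Ioo α 1, g u) ↔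
      ∀ F : ℝ → ℝ, MonotoneOn F (Set.Ico (0 : ℝ) 1) → (∀ u ∈ Set.Ico (0 : ℝ) 1, 0 ≤ F u) →
        ∫⁻ u in Set.Ioo (0 : ℝ) 1, f u * ENNReal.ofReal (F u) ≤
          ∫⁻ u in Set.Ioo (0 : ℝ) 1, g u * ENNReal.ofReal (F u) := by
  constructor
  · intro h F hF hF0
    have hFm := hF.mono Set.Ioo_subset_Ico_self
    set ν := volume.restrict (Set.Ioo (0 : ℝ) 1) with hν
    have hFν : AEMeasurable F ν := aemeasurable_restrict_of_monotoneOn measurableSet_Ioo hFm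
    have hFnn : 0 ≤ᵐ[ν] F := by
      filter_upwards [ae_restrict_mem measurableSet_Ioo] with u hu
      exact hF0 u (Set.Ioo_subset_Ico_self hu)
    rw [lintegral_mul_ofReal_eq hf hFν hFnn, lintegral_mul_ofReal_eq hg hFν hFnn]
    refine lintegral_mono fun t => ?_
    obtain ⟨β, hβ, hβ1, hβ2⟩ := hFm.exists_superlevel_Ioo t
    have hset : ({u | t < F u} : Set ℝ) =ᵐ[ν] Set.Ioo β 1 := by
      have hne : ∀ᵐ u ∂ν, u ≠ β :=
        compl_mem_ae_iff.2 (measure_singleton β)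
      filter_upwards [ae_restrict_mem measurableSet_Ioo, hne] with u hu hne
      refine propext ⟨fun h => ?_, fun h => hβ1 h⟩
      have := hβ2 ⟨hu, h⟩
      exact ⟨lt_of_le_of_ne this.1 hne.symm, this.2⟩
    have hval (k : ℝ → ℝ≥0∞) :
        ν.withDensity k {u | t < F u} = ∫⁻ u in Set.Ioo β 1, k u := by
      rw [measure_congr ((withDensity_absolutelyContinuous ν k).ae_le hset),
        withDensity_apply _ measurableSet_Ioo, hν, Measure.restrict_restrict measurableSet_Ioo,
        Set.inter_eq_left.2 (Set.Ioo_subset_Ioo_left hβ.1)]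
    rw [hval, hval]
    rcases hβ.2.eq_or_lt with rfl | hlt
    · simp
    · exact h β ⟨hβ.1, hlt⟩
  · intro h α hα
    have hmono : Monotone ((Set.Ioi α).indicator (fun _ => (1 : ℝ))) := by
      intro u v huv
      by_cases hu : u ∈ Set.Ioi α
      · rw [Set.indicator_of_mem hu, Set.indicator_of_mem (show v ∈ Set.Ioi α from hu.trans_le huv)]
      · rw [Set.indicator_of_notMem hu]
        exact Set.indicator_nonneg (fun _ _ => zero_le_one) _
    have hval (k : ℝ → ℝ≥0∞) : ∫⁻ u in Set.Ioo (0 : ℝ) 1,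
        k u * ENNReal.ofReal ((Set.Ioi α).indicator (fun _ => (1 : ℝ)) u) =
          ∫⁻ u in Set.Ioo α 1, k u := by
      have hfun : (fun u => k u * ENNReal.ofReal ((Set.Ioi α).indicator (fun _ => (1 : ℝ)) u)) =
          (Set.Ioi α).indicator k := by
        ext u
        by_cases hu : u ∈ Set.Ioi α <;> simp [Set.indicator_of_mem, Set.indicator_of_notMem, hu]
      have hset : Set.Ioi α ∩ Set.Ioo (0 : ℝ) 1 = Set.Ioo α 1 := by
        ext u
        exact ⟨fun h => ⟨h.1, h.2.2⟩, fun h => ⟨h.1, hα.1.trans_lt h.1, h.2⟩⟩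
      rw [hfun, setLIntegral_indicator measurableSet_Ioi, hset]
    have := h _ (hmono.monotoneOn _)
      fun u _ => Set.indicator_nonneg (fun _ _ => zero_le_one) u
    rwa [hval, hval] at this

lemma aemeasurable_quantileFn {P : Measure Ω} [IsProbabilityMeasure P] {X : Ω → ℝ}
    (hX : AEMeasurable X P) :
    AEMeasurable (quantileFn P X) (volume.restrict (Set.Ioo (0 : ℝ) 1)) :=
  aemeasurable_restrict_of_monotoneOn measurableSet_Ioo (monotoneOn_quantileFn hX)

lemma restrict_Ioo_le_restrict_Ioo_zero {β : ℝ} (hβ : 0 ≤ β) :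
    (volume.restrict (Set.Ioo β 1) : Measure ℝ) ≤ volume.restrict (Set.Ioo 0 1) :=
  Measure.restrict_mono (Set.Ioo_subset_Ioo_left hβ) le_rfl

/-- Among events of probability at most `1 - β`, the integral of `X` is at most the tail
integral of its quantile function. -/
lemma setLIntegral_le_setLIntegral_quantileFn {P : Measure Ω} [IsProbabilityMeasure P]
    {X : Ω → ℝ} (hX : AEMeasurable X P) (h0 : 0 ≤ᵐ[P] X) {C : Set Ω} {β : ℝ}
    (hβ : β ∈ Set.Icc (0 : ℝ) 1) (hC : P C ≤ ENNReal.ofReal (1 - β)) :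
    ∫⁻ ω in C, ENNReal.ofReal (X ω) ∂P ≤
      ∫⁻ u in Set.Ioo β 1, ENNReal.ofReal (quantileFn P X u) := by
  have hq0 : 0 ≤ᵐ[volume.restrict (Set.Ioo β 1)] quantileFn P X := by
    filter_upwards [ae_restrict_mem measurableSet_Ioo] with u hu
    exact quantileFn_nonneg hX h0 ⟨hβ.1.trans_lt hu.1, hu.2⟩
  rw [lintegral_eq_lintegral_meas_lt _ (ae_restrict_of_ae h0) hX.restrict,
    lintegral_eq_lintegral_meas_lt _ hq0
      ((aemeasurable_quantileFn hX).mono_measure (restrict_Ioo_le_restrict_Ioo_zero hβ.1))]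
  refine lintegral_mono fun t => ?_
  have hle : P.restrict C {ω | t < X ω} ≤ ENNReal.ofReal (1 - P.real {ω | X ω ≤ t}) := by
    have hc : {ω | t < X ω} = {ω | X ω ≤ t}ᶜ := by
      ext ω
      simp
    rw [ENNReal.ofReal_sub _ measureReal_nonneg, ofReal_measureReal, ENNReal.ofReal_one, hc,
      ← prob_compl_eq_one_sub₀ (nullMeasurableSet_le hX aemeasurable_const)]
    exact Measure.restrict_le_self _
  have hle' : P.restrict C {ω | t < X ω} ≤ ENNReal.ofReal (1 - β) :=
    ((measure_mono (Set.subset_univ _)).trans_eq (Measure.restrict_apply_univ C)).trans hC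
  have hsub : Set.Ioo (max β (P.real {ω | X ω ≤ t})) 1 ⊆
      {u | t < quantileFn P X u} ∩ Set.Ioo β 1 := by
    intro u hu
    have h1 := max_lt_iff.1 hu.1
    refine ⟨?_, h1.1, hu.2⟩
    by_contra h
    have h2 := (quantileFn_le_iff hX ⟨hβ.1.trans_lt h1.1, hu.2⟩).1 (not_lt.1 h)
    rw [← ofReal_measureReal, ENNReal.ofReal_le_ofReal_iff measureReal_nonneg] at h2
    exact absurd h1.2 (not_lt.2 h2)
  calc P.restrict C {ω | t < X ω}
      ≤ ENNReal.ofReal (1 - max β (P.real {ω | X ω ≤ t})) := by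
        rcases le_total β (P.real {ω | X ω ≤ t}) with h | h
        · rwa [max_eq_right h]
        · rwa [max_eq_left h]
    _ = volume (Set.Ioo (max β (P.real {ω | X ω ≤ t})) 1) := Real.volume_Ioo.symm
    _ ≤ volume ({u | t < quantileFn P X u} ∩ Set.Ioo β 1) := measure_mono hsub
    _ ≤ volume.restrict (Set.Ioo β 1) {u | t < quantileFn P X u} :=
        Measure.le_restrict_apply _ _

lemma IsUniformRV.measure_preimage_Ioo {P : Measure Ω} [IsProbabilityMeasure P] {U : Ω → ℝ}
    (hU : IsUniformRV P U) {α : ℝ} (hα : 0 ≤ α) :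
    P (U ⁻¹' Set.Ioo α 1) = ENNReal.ofReal (1 - α) := by
  rw [← Measure.map_apply hU.1 measurableSet_Ioo, hU.map_eq,
    Measure.restrict_apply measurableSet_Ioo, Set.inter_eq_left.2 (Set.Ioo_subset_Ioo_left hα),
    Real.volume_Ioo]

lemma IsUniformRV.setLIntegral_comp {P : Measure Ω} [IsProbabilityMeasure P] {U : Ω → ℝ}
    (hU : IsUniformRV P U) {f : ℝ → ℝ≥0∞}
    (hf : AEMeasurable f (volume.restrict (Set.Ioo (0 : ℝ) 1))) {α : ℝ} (hα : 0 ≤ α) :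
    ∫⁻ ω in U ⁻¹' Set.Ioo α 1, f (U ω) ∂P = ∫⁻ u in Set.Ioo α 1, f u := by
  have hm : (P.restrict (U ⁻¹' Set.Ioo α 1)).map U = volume.restrict (Set.Ioo α 1) := by
    rw [← Measure.restrict_map hU.1 measurableSet_Ioo, hU.map_eq,
      Measure.restrict_restrict measurableSet_Ioo,
      Set.inter_eq_left.2 (Set.Ioo_subset_Ioo_left hα)]
  rw [← hm, lintegral_map' _ hU.1.aemeasurable]
  rw [hm]
  exact hf.mono_measure (restrict_Ioo_le_restrict_Ioo_zero hα)

lemma IsDistortion.aemeasurable {σ : ℝ → ℝ} (hσ : IsDistortion σ) :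
    AEMeasurable σ (volume.restrict (Set.Ioo (0 : ℝ) 1)) :=
  aemeasurable_restrict_of_monotoneOn measurableSet_Ioo (hσ.mono.mono Set.Ioo_subset_Ico_self)

lemma IsDistortion.aemeasurable_comp {σ : ℝ → ℝ} (hσ : IsDistortion σ) {P : Measure Ω}
    [IsProbabilityMeasure P] {U : Ω → ℝ} (hU : IsUniformRV P U) :
    AEMeasurable (fun ω => σ (U ω)) P := by
  have h := hσ.aemeasurable
  rw [← hU.map_eq] at h
  exact h.comp_measurable hU.1

lemma IsDistortion.comp_nonneg {σ : ℝ → ℝ} (hσ : IsDistortion σ) {P : Measure Ω}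
    [IsProbabilityMeasure P] {U : Ω → ℝ} (hU : IsUniformRV P U) :
    0 ≤ᵐ[P] fun ω => σ (U ω) := by
  filter_upwards [hU.ae_mem_Ioo] with ω hω
  exact hσ.nonneg _ (Set.Ioo_subset_Ico_self hω)

lemma setLIntegral_mul_distortion_le {P : Measure Ω} [IsProbabilityMeasure P] {σ : ℝ → ℝ}
    (hσ : IsDistortion σ) {U X : Ω → ℝ} (hU : IsUniformRV P U) (hX : AEMeasurable X P)
    (h0 : 0 ≤ᵐ[P] X) {B : Set Ω} (hB : MeasurableSet B) {α : ℝ} (hα : α ∈ Set.Ico (0 : ℝ) 1)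
    (hBα : P B ≤ ENNReal.ofReal (1 - α)) :
    ∫⁻ ω in B, ENNReal.ofReal (X ω) * ENNReal.ofReal (σ (U ω)) ∂P ≤
      ∫⁻ u in Set.Ioo α 1, ENNReal.ofReal (quantileFn P X u) * ENNReal.ofReal (σ u) := by
  have hle := restrict_Ioo_le_restrict_Ioo_zero hα.1
  have hσ0 : 0 ≤ᵐ[volume.restrict (Set.Ioo α 1)] σ := by
    filter_upwards [ae_restrict_mem measurableSet_Ioo] with u hu
    exact hσ.nonneg u ⟨hα.1.trans hu.1.le, hu.2⟩
  rw [lintegral_mul_ofReal_eq hX.ennreal_ofReal.restrict (hσ.aemeasurable_comp hU).restrict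
      (ae_restrict_of_ae (hσ.comp_nonneg hU)),
    lintegral_mul_ofReal_eq ((aemeasurable_quantileFn hX).mono_measure hle).ennreal_ofReal
      (hσ.aemeasurable.mono_measure hle) hσ0]
  refine lintegral_mono fun s => ?_
  obtain ⟨β, hβ, hβ1, hβ2⟩ :=
    (hσ.mono.mono Set.Ioo_subset_Ico_self).exists_superlevel_Ioo s
  have hS : P {ω | s < σ (U ω)} ≤ ENNReal.ofReal (1 - β) := by
    calc P {ω | s < σ (U ω)} ≤ P (U ⁻¹' Set.Ico β 1) := by
          refine measure_mono_ae ?_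
          filter_upwards [hU.ae_mem_Ioo] with ω hω h
          exact hβ2 ⟨hω, h⟩
      _ ≤ volume (Set.Ico β 1) := by
          rw [← Measure.map_apply hU.1 measurableSet_Ico, hU.map_eq]
          exact Measure.restrict_le_self _
      _ = ENNReal.ofReal (1 - β) := Real.volume_Ico
  rw [withDensity_apply', withDensity_apply', Measure.restrict_restrict' hB]
  have hmax : max α β ∈ Set.Icc (0 : ℝ) 1 := ⟨hα.1.trans (le_max_left _ _), max_le hα.2.le hβ.2⟩
  refine (setLIntegral_le_setLIntegral_quantileFn hX h0 hmax ?_).trans ?_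
  · rcases le_total α β with h | h
    · rw [max_eq_right h]
      exact (measure_mono Set.inter_subset_left).trans hS
    · rw [max_eq_left h]
      exact (measure_mono Set.inter_subset_right).trans hBα
  · rw [Measure.restrict_restrict' measurableSet_Ioo]
    exact lintegral_mono_set fun u hu =>
      ⟨hβ1 ⟨(le_max_right _ _).trans_lt hu.1, hu.2⟩, (le_max_left _ _).trans_lt hu.1, hu.2⟩

lemma setLIntegral_quantileFn_mul_le {P : Measure Ω} [IsProbabilityMeasure P] {σ : ℝ → ℝ}
    (hσ : IsDistortion σ) {U X : Ω → ℝ} (hU : IsUniformRV P U) (hX : AEMeasurable X P)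
    (h0 : 0 ≤ᵐ[P] X) {α : ℝ} (hα : α ∈ Set.Ico (0 : ℝ) 1) :
    ∫⁻ u in Set.Ioo α 1, ENNReal.ofReal (quantileFn P (fun ω => σ (U ω) * X ω) u) ≤
      ∫⁻ u in Set.Ioo α 1, ENNReal.ofReal (σ u) * ENNReal.ofReal (quantileFn P X u) := by
  have hY : AEMeasurable (fun ω => σ (U ω) * X ω) P := (hσ.aemeasurable_comp hU).mul hX
  obtain ⟨W, hW, hle⟩ := exists_uniform_quantileFn_le ⟨U, hU⟩ hY
  rw [← hW.setLIntegral_comp (aemeasurable_quantileFn hY).ennreal_ofReal hα.1]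
  calc ∫⁻ ω in W ⁻¹' Set.Ioo α 1,
        ENNReal.ofReal (quantileFn P (fun ω => σ (U ω) * X ω) (W ω)) ∂P
      ≤ ∫⁻ ω in W ⁻¹' Set.Ioo α 1, ENNReal.ofReal (X ω) * ENNReal.ofReal (σ (U ω)) ∂P := by
        refine lintegral_mono_ae (ae_restrict_of_ae ?_)
        filter_upwards [hle, h0] with ω hω h0ω
        rw [← ENNReal.ofReal_mul h0ω, mul_comm (X ω)]
        exact ENNReal.ofReal_le_ofReal hω
    _ ≤ ∫⁻ u in Set.Ioo α 1, ENNReal.ofReal (quantileFn P X u) * ENNReal.ofReal (σ u) :=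
        setLIntegral_mul_distortion_le hσ hU hX h0 (hW.1 measurableSet_Ioo) hα
          (hW.measure_preimage_Ioo hα.1).le
    _ = _ := by simp_rw [mul_comm]

lemma le_setLIntegral_quantileFn_mul {P : Measure Ω} [IsProbabilityMeasure P] {σ : ℝ → ℝ}
    (hσ : IsDistortion σ) {U X : Ω → ℝ} (hU : IsUniformRV P U) (hX : AEMeasurable X P)
    (h0 : 0 ≤ᵐ[P] X) (hUX : ∀ᵐ ω ∂P, quantileFn P X (U ω) ≤ X ω) {α : ℝ}
    (hα : α ∈ Set.Ico (0 : ℝ) 1) :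
    ∫⁻ u in Set.Ioo α 1, ENNReal.ofReal (σ u) * ENNReal.ofReal (quantileFn P X u) ≤
      ∫⁻ u in Set.Ioo α 1, ENNReal.ofReal (quantileFn P (fun ω => σ (U ω) * X ω) u) := by
  have hY : AEMeasurable (fun ω => σ (U ω) * X ω) P := (hσ.aemeasurable_comp hU).mul hX
  have hY0 : 0 ≤ᵐ[P] fun ω => σ (U ω) * X ω := by
    filter_upwards [hσ.comp_nonneg hU, h0] with ω h1 h2
    exact mul_nonneg h1 h2
  rw [← hU.setLIntegral_comp
    (f := fun u => ENNReal.ofReal (σ u) * ENNReal.ofReal (quantileFn P X u))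
    (hσ.aemeasurable.ennreal_ofReal.mul (aemeasurable_quantileFn hX).ennreal_ofReal) hα.1]
  refine le_trans ?_ (setLIntegral_le_setLIntegral_quantileFn hY hY0 ⟨hα.1, hα.2.le⟩
    (hU.measure_preimage_Ioo hα.1).le)
  refine lintegral_mono_ae (ae_restrict_of_ae ?_)
  filter_upwards [hUX, hσ.comp_nonneg hU] with ω h1 h2
  rw [ENNReal.ofReal_mul h2]
  exact mul_le_mul_right (ENNReal.ofReal_le_ofReal h1) _

lemma IsDistortion.integrableOn {σ : ℝ → ℝ} (hσ : IsDistortion σ) :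
    IntegrableOn σ (Set.Ioo (0 : ℝ) 1) := by
  by_contra h
  have := hσ.integral_one
  rw [integral_undef h] at this
  exact zero_ne_one this

lemma IsDistortion.ofReal_tail {σ : ℝ → ℝ} (hσ : IsDistortion σ) {α : ℝ} (hα : 0 ≤ α) :
    ENNReal.ofReal (∫ u in Set.Ioo α 1, σ u) =
      ∫⁻ u in Set.Ioo α 1, ENNReal.ofReal (σ u) := by
  refine ofReal_integral_eq_lintegral_ofReal
    (hσ.integrableOn.mono_set (Set.Ioo_subset_Ioo_left hα)) ?_
  filter_upwards [ae_restrict_mem measurableSet_Ioo] with u hu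
  exact hσ.nonneg u ⟨hα.trans hu.1.le, hu.2⟩

lemma IsDistortion.tail_pos {σ : ℝ → ℝ} (hσ : IsDistortion σ) {α : ℝ}
    (hα : α ∈ Set.Ico (0 : ℝ) 1) : 0 < ∫ u in Set.Ioo α 1, σ u := by
  have hnn : 0 ≤ᵐ[volume.restrict (Set.Ioo α 1)] σ := by
    filter_upwards [ae_restrict_mem measurableSet_Ioo] with u hu
    exact hσ.nonneg u ⟨hα.1.trans hu.1.le, hu.2⟩
  refine lt_of_le_of_ne (integral_nonneg_of_ae hnn) fun h => ?_
  have hz := (integral_eq_zero_iff_of_nonneg_ae hnn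
    (hσ.integrableOn.mono_set (Set.Ioo_subset_Ioo_left hα.1))).1 h.symm
  have hall : ∀ u ∈ Set.Ioo (0 : ℝ) 1, σ u = 0 := by
    intro u hu
    have hpos : volume (Set.Ioo (max α u) 1) ≠ 0 := by
      rw [Real.volume_Ioo]
      simpa using ⟨hα.2, hu.2⟩
    have hz' : ∀ᵐ v ∂volume.restrict (Set.Ioo (max α u) 1), σ v = 0 :=
      ae_mono (Measure.restrict_mono (Set.Ioo_subset_Ioo_left (le_max_left _ _)) le_rfl) hz
    have : (ae (volume.restrict (Set.Ioo (max α u) 1))).NeBot := by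
      rw [ae_restrict_neBot]
      exact hpos
    obtain ⟨v, hv, hv'⟩ := (hz'.and (ae_restrict_mem measurableSet_Ioo)).exists
    have huv : u ≤ v := (le_max_right _ _).trans hv'.1.le
    exact le_antisymm (hv ▸ hσ.mono ⟨hu.1.le, hu.2⟩ ⟨hu.1.le.trans huv, hv'.2⟩ huv)
      (hσ.nonneg u ⟨hu.1.le, hu.2⟩)
  have h1 := hσ.integral_one
  rw [setIntegral_congr_fun measurableSet_Ioo (g := fun _ => (0 : ℝ)) hall] at h1
  simp at h1

lemma avar_le_avar_iff {P : Measure Ω} {X Y : Ω → ℝ} {α : ℝ} (hα : α < 1) :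
    avar P X α ≤ avar P Y α ↔
      ∫⁻ u in Set.Ioo α 1, ENNReal.ofReal (quantileFn P X u) ≤
        ∫⁻ u in Set.Ioo α 1, ENNReal.ofReal (quantileFn P Y u) := by
  refine ENNReal.mul_le_mul_iff_right ?_ ENNReal.ofReal_ne_top
  rw [Ne, ENNReal.ofReal_eq_zero, not_le]
  exact one_div_pos.2 (sub_pos.2 hα)

/-- σ-dominance as a comparison of tail integrals of quantile functions. -/
lemma sigmaDominates_iff {P : Measure Ω} [IsProbabilityMeasure P]
    (hrich : ∃ U : Ω → ℝ, IsUniformRV P U) {σ : ℝ → ℝ} (hσ : IsDistortion σ) {Z Z' : Ω → 𝕂}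
    (hZ' : AEStronglyMeasurable Z' P) :
    SigmaDominates P σ Z' Z ↔ ∀ α ∈ Set.Ico (0 : ℝ) 1,
      ∫⁻ u in Set.Ioo α 1, ENNReal.ofReal (quantileFn P (fun ω => ‖Z ω‖) u) ≤
        ∫⁻ u in Set.Ioo α 1,
          ENNReal.ofReal (σ u) * ENNReal.ofReal (quantileFn P (fun ω => ‖Z' ω‖) u) := by
  have hX : AEMeasurable (fun ω => ‖Z' ω‖) P := hZ'.norm.aemeasurable
  have h0 : 0 ≤ᵐ[P] fun ω => ‖Z' ω‖ := ae_of_all _ fun ω => norm_nonneg _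
  constructor
  · rintro ⟨U, hU, h⟩ α hα
    exact ((avar_le_avar_iff hα.2).1 (h α hα)).trans
      (setLIntegral_quantileFn_mul_le hσ hU hX h0 hα)
  · intro h
    obtain ⟨U, hU, hUX⟩ := exists_uniform_quantileFn_le hrich hX
    exact ⟨U, hU, fun α hα => (avar_le_avar_iff hα.2).2
      ((h α hα).trans (le_setLIntegral_quantileFn_mul hσ hU hX h0 hUX hα))⟩

lemma dualNormInf_le_iff {P : Measure Ω} {σ : ℝ → ℝ} (hσ : IsDistortion σ) {Z : Ω → 𝕂}
    {η : ℝ≥0∞} :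
    dualNormInf P σ Z ≤ η ↔ ∀ α ∈ Set.Ico (0 : ℝ) 1,
      ∫⁻ u in Set.Ioo α 1, ENNReal.ofReal (quantileFn P (fun ω => ‖Z ω‖) u) ≤
        ∫⁻ u in Set.Ioo α 1, η * ENNReal.ofReal (σ u) := by
  simp only [dualNormInf, iSup_le_iff]
  refine forall₂_congr fun α hα => ?_
  rw [lintegral_const_mul'' _ ((hσ.aemeasurable.mono_measure
      (restrict_Ioo_le_restrict_Ioo_zero hα.1)).ennreal_ofReal), ← hσ.ofReal_tail hα.1]
  exact ENNReal.div_le_iff (ENNReal.ofReal_pos.2 (hσ.tail_pos hα)).ne' ENNReal.ofReal_ne_top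

/-- Characterizations of `|Z|*_{σ,∞}` and `|Z|*_{σ,q}` by testing
against all nonnegative nondecreasing functions `F` on `[0,1)`. -/
theorem statement10
    (P : Measure Ω) [IsProbabilityMeasure P]
    (hrich : ∃ U : Ω → ℝ, IsUniformRV P U)
    {𝕂 : Type*} [RCLike 𝕂]
    (σ : ℝ → ℝ) (hσ : IsDistortion σ)
    (Z : Ω → 𝕂) (hZ : AEStronglyMeasurable Z P) :
    dualNormInf P σ Z
      = sInf {η : ℝ≥0∞ |
          ∀ F : ℝ → ℝ, MonotoneOn F (Set.Ico (0 : ℝ) 1) →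
            (∀ u ∈ Set.Ico (0 : ℝ) 1, 0 ≤ F u) →
            ∫⁻ u in Set.Ioo (0 : ℝ) 1,
                ENNReal.ofReal (quantileFn P (fun ω => ‖Z ω‖) u) * ENNReal.ofReal (F u)
              ≤ η * ∫⁻ u in Set.Ioo (0 : ℝ) 1,
                  ENNReal.ofReal (σ u) * ENNReal.ofReal (F u)} ∧
    ∀ p q : ℝ, 1 < p → 1 / p + 1 / q = 1 →
      dualNormQ P σ q Z
        = sInf {r : ℝ≥0∞ | ∃ Z' : Ω → 𝕂, AEStronglyMeasurable Z' P ∧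
            (∀ F : ℝ → ℝ, MonotoneOn F (Set.Ico (0 : ℝ) 1) →
              (∀ u ∈ Set.Ico (0 : ℝ) 1, 0 ≤ F u) →
              ∫⁻ u in Set.Ioo (0 : ℝ) 1,
                  ENNReal.ofReal (quantileFn P (fun ω => ‖Z ω‖) u) * ENNReal.ofReal (F u)
                ≤ ∫⁻ u in Set.Ioo (0 : ℝ) 1,
                    ENNReal.ofReal (σ u) *
                      ENNReal.ofReal (quantileFn P (fun ω => ‖Z' ω‖) u) *
                        ENNReal.ofReal (F u)) ∧
            r = sigmaNorm P σ q Z'} := by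
  have hX : AEMeasurable (fun ω => ‖Z ω‖) P := hZ.norm.aemeasurable
  have hQ := (aemeasurable_quantileFn hX).ennreal_ofReal
  have hσm := hσ.aemeasurable.ennreal_ofReal
  constructor
  · rw [← csInf_Ici (a := dualNormInf P σ Z)]
    congr 1
    ext η
    rw [Set.mem_Ici, dualNormInf_le_iff hσ,
      forall_setLIntegral_Ioo_le_iff hQ (hσm.const_mul η)]
    refine forall₃_congr fun F hF _ => ?_
    have hFm : AEMeasurable F (volume.restrict (Set.Ioo (0 : ℝ) 1)) :=
      aemeasurable_restrict_of_monotoneOn measurableSet_Ioo (hF.mono Set.Ioo_subset_Ico_self)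
    simp only [mul_assoc]
    rw [lintegral_const_mul'' η (f := fun u => ENNReal.ofReal (σ u) * ENNReal.ofReal (F u))
      (hσm.mul hFm.ennreal_ofReal)]
  · intro p q _ _
    have hiff (Z' : Ω → 𝕂) (hZ' : AEStronglyMeasurable Z' P) :=
      (sigmaDominates_iff hrich hσ (Z := Z) hZ').trans
        (forall_setLIntegral_Ioo_le_iff hQ
          (hσm.mul (aemeasurable_quantileFn hZ'.norm.aemeasurable).ennreal_ofReal))
    refine le_antisymm (le_sInf ?_) (le_iInf₂ fun Z' h => sInf_le ?_)
    · rintro r ⟨Z', hZ', h, rfl⟩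
      exact iInf₂_le Z' ⟨hZ', (hiff Z' hZ').2 h⟩
    · exact ⟨Z', h.1, (hiff Z' h.1).1 h.2, rfl⟩

end
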